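/- Let f : D → 𝓡 be a query function and let p be an ε-differentially private discrete mechanism with discretization q. For each x ∈ D define the expected distortions E_pˣ := Σ_{r∈𝓡} pˣ(r)·d(f(x),r) and E_qˣ := Σ_{r∈𝓡} qˣ(r)·d(f(x),r) (sums taken in [0,∞]). Then for every x ∈ D, exp(−ε)·E_qˣ ≤ E_pˣ ≤ exp(ε)·E_qˣ. -/

import Mathlib

/-- The `i`-th layer of the probability distribution `p x`:
`R_i^x = {r | M exp(-(i+1)ε) < p x r ≤ M exp(-i ε)}`. -/
def layerSet {D R : Type*} (p : D → R → ℝ) (ε M : ℝ) (x : D) (i : ℕ) : Set R :=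
  {r | M * Real.exp (-((i : ℝ) + 1) * ε) < p x r ∧ p x r ≤ M * Real.exp (-(i : ℝ) * ε)}

/-- `A_j^x`, the union of the layers of index `≤ j`. -/
def cumSet {D R : Type*} (p : D → R → ℝ) (ε M : ℝ) (x : D) (j : ℕ) : Set R :=
  ⋃ k ≤ j, layerSet p ε M x k

/-- `ε`-differential privacy of a discrete mechanism: for all neighbors `x, x'`
(i.e. `0 < d̄(x,x') ≤ 1`) and all `r`, `p x r ≤ exp ε * p x' r`. -/
def IsDP {D R : Type*} [PseudoMetricSpace D] (p : D → R → ℝ) (ε : ℝ) : Prop :=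
  ∀ x x' : D, 0 < dist x x' → dist x x' ≤ 1 → ∀ r : R, p x r ≤ Real.exp ε * p x' r

/-- Utility comparison between an `ε`-differentially private discrete mechanism
`p` and its discretization `q`: the expected distortions (sums in `[0,∞]`)
satisfy `exp(-ε) E_q^x ≤ E_p^x ≤ exp(ε) E_q^x` for every dataset `x`. -/
theorem stmt_4 {D R : Type*} [MetricSpace D] [MetricSpace R] [Countable R]
    (f : D → R)
    (p : D → R → ℝ) (ε : ℝ) (hε : 0 < ε)
    (hpos : ∀ (x : D) (r : R), 0 < p x r) (hsum1 : ∀ x : D, HasSum (p x) 1)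
    (M : ℝ) (hMpos : 0 < M)
    (hM : IsLUB {v : ℝ | ∃ (x : D) (r : R), v = p x r} M)
    (hdp : IsDP p ε)
    (L : D → R → ℕ) (hL : ∀ (x : D) (r : R), r ∈ layerSet p ε M x (L x r))
    (α : D → ℝ) (hα : ∀ x : D, HasSum (fun r : R => Real.exp (-(L x r : ℝ) * ε)) (α x))
    (hαpos : ∀ x : D, 0 < α x) :
    ∀ x : D,
      ENNReal.ofReal (Real.exp (-ε)) *
          (∑' r : R, ENNReal.ofReal (Real.exp (-(L x r : ℝ) * ε) / α x * dist (f x) r)) ≤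
        (∑' r : R, ENNReal.ofReal (p x r * dist (f x) r)) ∧
      (∑' r : R, ENNReal.ofReal (p x r * dist (f x) r)) ≤
        ENNReal.ofReal (Real.exp ε) *
          (∑' r : R, ENNReal.ofReal (Real.exp (-(L x r : ℝ) * ε) / α x * dist (f x) r)) := by
  intro x
  have hlow : ∀ r, M * Real.exp (-ε) * Real.exp (-(L x r : ℝ) * ε) ≤ p x r := by
    intro r
    have h := (hL x r).1.le
    have e : Real.exp (-((L x r : ℝ) + 1) * ε) = Real.exp (-ε) * Real.exp (-(L x r : ℝ) * ε) := by
      rw [← Real.exp_add]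
      congr 1
      ring
    rw [e, ← mul_assoc] at h
    exact h
  have hup : ∀ r, p x r ≤ M * Real.exp (-(L x r : ℝ) * ε) := fun r => (hL x r).2
  have h1 : M * Real.exp (-ε) * α x ≤ 1 :=
    hasSum_le hlow ((hα x).mul_left _) (hsum1 x)
  have h2 : 1 ≤ M * α x := hasSum_le hup (hsum1 x) ((hα x).mul_left _)
  have ha := hαpos x
  have hee : Real.exp ε * Real.exp (-ε) = 1 := by
    rw [← Real.exp_add]
    simp
  rw [← ENNReal.tsum_mul_left, ← ENNReal.tsum_mul_left]
  constructor
  · refine ENNReal.tsum_le_tsum fun r => ?_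
    rw [← ENNReal.ofReal_mul (Real.exp_pos _).le, ← mul_assoc]
    refine ENNReal.ofReal_le_ofReal (mul_le_mul_of_nonneg_right ?_ dist_nonneg)
    rw [← mul_div_assoc, div_le_iff₀ ha]
    have hE : 0 < Real.exp (-ε) * Real.exp (-(L x r : ℝ) * ε) := by positivity
    calc Real.exp (-ε) * Real.exp (-(L x r : ℝ) * ε)
        ≤ (M * α x) * (Real.exp (-ε) * Real.exp (-(L x r : ℝ) * ε)) :=
          le_mul_of_one_le_left hE.le h2
      _ = (M * Real.exp (-ε) * Real.exp (-(L x r : ℝ) * ε)) * α x := by ring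
      _ ≤ p x r * α x := mul_le_mul_of_nonneg_right (hlow r) ha.le
  · refine ENNReal.tsum_le_tsum fun r => ?_
    rw [← ENNReal.ofReal_mul (Real.exp_pos _).le, ← mul_assoc]
    refine ENNReal.ofReal_le_ofReal (mul_le_mul_of_nonneg_right ?_ dist_nonneg)
    rw [← mul_div_assoc, le_div_iff₀ ha]
    have hE : 0 < Real.exp ε * Real.exp (-(L x r : ℝ) * ε) := by positivity
    calc p x r * α x ≤ (M * Real.exp (-(L x r : ℝ) * ε)) * α x :=
          mul_le_mul_of_nonneg_right (hup r) ha.le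
      _ = (Real.exp ε * Real.exp (-ε)) * ((M * Real.exp (-(L x r : ℝ) * ε)) * α x) := by
          rw [hee, one_mul]
      _ = (M * Real.exp (-ε) * α x) * (Real.exp ε * Real.exp (-(L x r : ℝ) * ε)) := by ring
      _ ≤ Real.exp ε * Real.exp (-(L x r : ℝ) * ε) := mul_le_of_le_one_left hE.le h1
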